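/- arXiv:2305.13185 — 6 statements merged into one kernel-verified Lean document; each statement's English description precedes it below -/
import Mathlib

section
/- Let d ≥ 1 and let Φ ⊂ ℝ^d be a compact set that spans ℝ^d. Then there exists a probability distribution ρ on ℝ^d whose support C is a finite subset of Φ of size at most 4·d·log(log(d+4)) + 28 (natural logarithms) such that the design matrix G = ∑_{x ∈ C} ρ({x}) x xᵀ is invertible and sup_{φ ∈ Φ} φᵀ G⁻¹ φ ≤ 2d. -/
open Matrix

section ExchangeArgument

variable {n ι : Type*} [Fintype n] [DecidableEq n] [Fintype ι]

/-- The determinant after exchanging a rank-one summand `x xᵀ` for `φ φᵀ`. -/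
theorem det_sub_vecMulVec_add_vecMulVec (A : Matrix n n ℝ) (hA : IsUnit A.det) (x φ : n → ℝ) :
    (A - vecMulVec x x + vecMulVec φ φ).det =
      A.det * ((1 - x ⬝ᵥ (A⁻¹ *ᵥ x)) * (1 + φ ⬝ᵥ (A⁻¹ *ᵥ φ)) +
        (φ ⬝ᵥ (A⁻¹ *ᵥ x)) * (x ⬝ᵥ (A⁻¹ *ᵥ φ))) := by
  have hUV : A - vecMulVec x x + vecMulVec φ φ =
      A + (Matrix.of ![-x, φ])ᵀ * Matrix.of ![x, φ] := by
    ext i j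
    simp [mul_apply, vecMulVec_apply, Fin.sum_univ_two]
    ring
  have hentry (i j : Fin 2) : (Matrix.of ![x, φ] * A⁻¹ * (Matrix.of ![-x, φ])ᵀ) i j =
      ![x, φ] i ⬝ᵥ (A⁻¹ *ᵥ ![-x, φ] j) := by
    rw [Matrix.mul_assoc, mul_apply_eq_vecMul]
    rfl
  rw [hUV, det_add_mul _ _ hA, det_fin_two]
  simp only [Matrix.add_apply, hentry]
  congr 1
  simp [mulVec_neg]
  ring

/-- A family maximizing the determinant of its scatter matrix under exchanges of one vector
for `φ` has bounded leverage at `φ`. -/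
theorem leverage_le_of_det_update_le [DecidableEq ι] (f : ι → n → ℝ) (φ : n → ℝ)
    (hpos : 0 < (∑ i, vecMulVec (f i) (f i)).det)
    (hmax : ∀ i, (∑ j, vecMulVec (Function.update f i φ j) (Function.update f i φ j)).det ≤
      (∑ j, vecMulVec (f j) (f j)).det) :
    (Fintype.card ι - Fintype.card n + 1 : ℝ) *
      (φ ⬝ᵥ ((∑ i, vecMulVec (f i) (f i))⁻¹ *ᵥ φ)) ≤ Fintype.card n := by
  set A := ∑ i, vecMulVec (f i) (f i) with hAdef
  have hA : IsUnit A.det := hpos.ne'.isUnit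
  have hexchange (i : ι) :
      (1 - f i ⬝ᵥ (A⁻¹ *ᵥ f i)) * (1 + φ ⬝ᵥ (A⁻¹ *ᵥ φ)) +
        (φ ⬝ᵥ (A⁻¹ *ᵥ f i)) * (f i ⬝ᵥ (A⁻¹ *ᵥ φ)) ≤ 1 := by
    have hsum : ∑ j, vecMulVec (Function.update f i φ j) (Function.update f i φ j) =
        A - vecMulVec (f i) (f i) + vecMulVec φ φ := by
      rw [hAdef, ← Finset.add_sum_erase _ _ (Finset.mem_univ i),
        ← Finset.add_sum_erase _ (fun j => vecMulVec (f j) (f j)) (Finset.mem_univ i),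
        Finset.sum_congr rfl (g := fun j => vecMulVec (f j) (f j))]
      · simp
        abel
      · intro j hj
        rw [Function.update_of_ne (Finset.ne_of_mem_erase hj)]
    have h := hmax i
    rw [hsum, det_sub_vecMulVec_add_vecMulVec A hA] at h
    exact le_of_mul_le_mul_left (by simpa using h) hpos
  have htrace : ∑ i, f i ⬝ᵥ (A⁻¹ *ᵥ f i) = Fintype.card n := by
    calc ∑ i, f i ⬝ᵥ (A⁻¹ *ᵥ f i) = (A⁻¹ * A).trace := by
          rw [hAdef, Finset.mul_sum, trace_sum]
          refine Finset.sum_congr rfl fun i _ => ?_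
          rw [mul_vecMulVec, trace_vecMulVec, dotProduct_comm]
      _ = Fintype.card n := by rw [nonsing_inv_mul A hA, trace_one]
  have hcross : ∑ i, (φ ⬝ᵥ (A⁻¹ *ᵥ f i)) * (f i ⬝ᵥ (A⁻¹ *ᵥ φ)) = φ ⬝ᵥ (A⁻¹ *ᵥ φ) := by
    calc ∑ i, (φ ⬝ᵥ (A⁻¹ *ᵥ f i)) * (f i ⬝ᵥ (A⁻¹ *ᵥ φ))
        = φ ⬝ᵥ (A⁻¹ *ᵥ (A *ᵥ (A⁻¹ *ᵥ φ))) := by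
          conv_rhs => rw [hAdef]
          rw [sum_mulVec, mulVec_sum, dotProduct_sum]
          refine Finset.sum_congr rfl fun i _ => ?_
          rw [vecMulVec_mulVec, op_smul_eq_smul, mulVec_smul, dotProduct_smul, smul_eq_mul,
            mul_comm]
      _ = φ ⬝ᵥ (A⁻¹ *ᵥ φ) := by
          rw [mulVec_mulVec _ A, mul_nonsing_inv A hA, one_mulVec]
  have htotal := Finset.sum_le_sum fun i (_ : i ∈ Finset.univ) => hexchange i
  rw [Finset.sum_add_distrib, ← Finset.sum_mul, Finset.sum_sub_distrib, htrace, hcross] at htotal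
  simp only [Finset.sum_const, Finset.card_univ, nsmul_eq_mul, mul_one] at htotal
  linarith

end ExchangeArgument

/-- A compact spanning set contains `2d` vectors (with repetition) whose scatter matrix has
positive determinant and leverage at most one on the whole set. -/
theorem exists_family_leverage_le_one {d : ℕ} {Φ : Set (Fin d → ℝ)} (hcompact : IsCompact Φ)
    (hspan : Submodule.span ℝ Φ = ⊤) :
    ∃ f : Fin d ⊕ Fin d → Fin d → ℝ, (∀ i, f i ∈ Φ) ∧
      0 < (∑ i, vecMulVec (f i) (f i)).det ∧
      ∀ φ ∈ Φ, φ ⬝ᵥ ((∑ i, vecMulVec (f i) (f i))⁻¹ *ᵥ φ) ≤ 1 := by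
  have hrank : Module.finrank ℝ (Submodule.span ℝ Φ) = d := by
    rw [hspan, finrank_top, Module.finrank_fin_fun]
  obtain ⟨b, hbΦ, hb⟩ : ∃ b : Fin d → Fin d → ℝ, (∀ i, b i ∈ Φ) ∧ LinearIndependent ℝ b := by
    obtain ⟨b, hbΦ, -, hb⟩ := Submodule.exists_fun_fin_finrank_span_eq ℝ Φ
    exact ⟨b ∘ Fin.cast hrank.symm, fun i => hbΦ _, hb.comp _ (Fin.cast_injective _)⟩
  have hbdet : (Matrix.of b).det ≠ 0 := by
    have := linearIndependent_rows_iff_isUnit.mp (show LinearIndependent ℝ (Matrix.of b).row from hb)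
    exact ((isUnit_iff_isUnit_det _).mp this).ne_zero
  have hinit : 0 < (∑ i, vecMulVec (Sum.elim b b i) (Sum.elim b b i)).det := by
    have hgram : ∑ i, vecMulVec (Sum.elim b b i) (Sum.elim b b i) =
        (2 : ℝ) • ((Matrix.of b)ᵀ * Matrix.of b) := by
      ext i j
      simp [Matrix.sum_apply, mul_apply, vecMulVec_apply, two_mul]
    rw [hgram, det_smul, det_mul, det_transpose]
    have := mul_self_pos.mpr hbdet
    positivity
  have hcont : Continuous fun f : Fin d ⊕ Fin d → Fin d → ℝ =>
      (∑ i, vecMulVec (f i) (f i)).det := by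
    refine Continuous.matrix_det (continuous_finsetSum _ fun i _ => ?_)
    exact (continuous_apply i).matrix_vecMulVec (continuous_apply i)
  obtain ⟨f, hfΦ, hf⟩ := (isCompact_univ_pi fun _ : Fin d ⊕ Fin d => hcompact).exists_isMaxOn
    ⟨Sum.elim b b, by rintro (i | i) - <;> exact hbΦ i⟩ hcont.continuousOn
  have hpos := hinit.trans_le (hf (show Sum.elim b b ∈ Set.univ.pi fun _ => Φ by
    rintro (i | i) - <;> exact hbΦ i))
  refine ⟨f, fun i => hfΦ i trivial, hpos, fun φ hφ => ?_⟩
  have h := leverage_le_of_det_update_le f φ hpos fun i => hf (by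
    intro j _
    rcases eq_or_ne j i with rfl | hj
    · simpa using hφ
    · simpa [hj] using hfΦ j trivial)
  simp only [Fintype.card_sum, Fintype.card_fin] at h
  push_cast at h
  have hd : (0 : ℝ) ≤ d := d.cast_nonneg
  by_contra! hlt
  nlinarith

theorem two_mul_le_four_mul_log_log_add (d : ℕ) (hd : 1 ≤ d) :
    (2 * d : ℝ) ≤ 4 * d * Real.log (Real.log (d + 4)) + 28 := by
  have hd' : (1 : ℝ) ≤ d := by exact_mod_cast hd
  rcases le_or_gt d 14 with h | h
  · have h' : (d : ℝ) ≤ 14 := by exact_mod_cast h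
    have hlog : 1 ≤ Real.log (d + 4) := by
      rw [Real.le_log_iff_exp_le (by positivity)]
      linarith [Real.exp_one_lt_d9]
    have := mul_nonneg (by positivity : (0 : ℝ) ≤ 4 * d) (Real.log_nonneg hlog)
    linarith
  · have h' : (15 : ℝ) ≤ d := by exact_mod_cast h
    have he := Real.exp_one_lt_d9
    have hlog : 2 ≤ Real.log (d + 4) := by
      rw [Real.le_log_iff_exp_le (by positivity), show (2 : ℝ) = 1 + 1 by norm_num, Real.exp_add]
      nlinarith [Real.exp_pos 1]
    have hloglog : 1 / 2 ≤ Real.log (Real.log (d + 4)) := by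
      linarith [Real.log_le_log two_pos hlog, Real.log_two_gt_d9]
    nlinarith

/-- Kiefer–Wolfowitz theorem for compact feature sets (Theorem 3.2): a compact spanning set
`Φ ⊆ ℝ^d` admits a near-optimal design with core set of size at most `4d·log(log(d+4)) + 28`. -/
theorem kiefer_wolfowitz_compact
    (d : ℕ) (hd : 1 ≤ d) (Φ : Set (Fin d → ℝ))
    (hcompact : IsCompact Φ)
    (hspan : Submodule.span ℝ Φ = ⊤) :
    ∃ (C : Finset (Fin d → ℝ)) (ρ : (Fin d → ℝ) → ℝ),
      ↑C ⊆ Φ ∧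
      (C.card : ℝ) ≤ 4 * d * Real.log (Real.log (d + 4)) + 28 ∧
      (∀ x ∈ C, 0 < ρ x) ∧
      ∑ x ∈ C, ρ x = 1 ∧
      IsUnit (∑ x ∈ C, ρ x • vecMulVec x x) ∧
      ∀ φ ∈ Φ, φ ⬝ᵥ ((∑ x ∈ C, ρ x • vecMulVec x x)⁻¹ *ᵥ φ) ≤ 2 * d := by
  classical
  obtain ⟨f, hfΦ, hpos, hlev⟩ := exists_family_leverage_le_one hcompact hspan
  have hd0 : (0 : ℝ) < 2 * d := by
    have : (0 : ℝ) < d := by exact_mod_cast hd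
    positivity
  set A := ∑ i, vecMulVec (f i) (f i) with hAdef
  have hA : IsUnit A.det := hpos.ne'.isUnit
  let mult (x : Fin d → ℝ) : ℕ := (Finset.univ.filter fun i => f i = x).card
  have hG : ∑ x ∈ Finset.univ.image f, ((2 * d : ℝ)⁻¹ * mult x) • vecMulVec x x =
      (2 * d : ℝ)⁻¹ • A := by
    rw [hAdef, Finset.sum_comp (fun x => vecMulVec x x) f, Finset.smul_sum]
    refine Finset.sum_congr rfl fun x _ => ?_
    rw [mul_smul, Nat.cast_smul_eq_nsmul]
  have hGinv : ((2 * d : ℝ)⁻¹ • A)⁻¹ = (2 * d : ℝ) • A⁻¹ := by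
    refine inv_eq_right_inv ?_
    rw [smul_mul_smul_comm, mul_nonsing_inv A hA, inv_mul_cancel₀ hd0.ne', one_smul]
  refine ⟨Finset.univ.image f, fun x => (2 * d : ℝ)⁻¹ * mult x, ?_, ?_, ?_, ?_, ?_, ?_⟩
  · intro x hx
    obtain ⟨i, -, rfl⟩ := Finset.mem_image.mp (Finset.mem_coe.mp hx)
    exact hfΦ i
  · refine le_trans ?_ (two_mul_le_four_mul_log_log_add d hd)
    have : (Finset.univ.image f).card ≤ 2 * d := by
      simpa [two_mul] using Finset.card_image_le (s := Finset.univ) (f := f)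
    exact_mod_cast this
  · intro x hx
    obtain ⟨i, -, rfl⟩ := Finset.mem_image.mp hx
    have : 0 < mult (f i) := Finset.card_pos.mpr ⟨i, by simp⟩
    positivity
  · have hcard : ∑ x ∈ Finset.univ.image f, mult x = 2 * d := by
      rw [← Finset.card_eq_sum_card_image]
      simp [two_mul]
    rw [← Finset.mul_sum, ← Nat.cast_sum, hcard]
    push_cast
    exact inv_mul_cancel₀ hd0.ne'
  · rw [hG, isUnit_iff_isUnit_det, det_smul]
    exact (IsUnit.pow _ (inv_ne_zero hd0.ne').isUnit).mul hA
  · intro φ hφ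
    rw [hG, hGinv, smul_mulVec, dotProduct_smul, smul_eq_mul]
    exact mul_le_of_le_one_right hd0.le (hlev φ hφ)
end

section
/- Let d ≥ 1, let S be a set, φ : S → ℝ^d a feature map, and f : S → (0,∞) a positive weighting function such that the weighted feature set Φ_f = { φ(s)/f(s) : s ∈ S } is a compact subset of ℝ^d that spans ℝ^d. Then there exists a probability distribution ρ_f on S with finite support C_f of size at most 4·d·log(log(d+4)) + 28 (natural logarithms) such that the weighted design matrix G_f = ∑_{y ∈ C_f} ρ_f(y) φ(y)φ(y)ᵀ / f(y)² is invertible and g_f(ρ_f) = sup_{s ∈ S} φ(s)ᵀ G_f⁻¹ φ(s) / f(s)² ≤ 2d. -/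
open Matrix

section DesignMatrix

variable {ι n : Type*} [Fintype ι]

/-- The (unnormalized) design matrix `∑ i, x i (x i)ᵀ` of a family of vectors. -/
def designMatrix (x : ι → n → ℝ) : Matrix n n ℝ := ∑ i, vecMulVec (x i) (x i)

theorem designMatrix_eq_transpose_mul (x : ι → n → ℝ) :
    designMatrix x = (Matrix.of x)ᵀ * Matrix.of x := by
  ext a b
  simp [designMatrix, Matrix.sum_apply, vecMulVec_apply, Matrix.mul_apply]

theorem designMatrix_update [DecidableEq ι] (x : ι → n → ℝ) (i : ι) (u : n → ℝ) :
    designMatrix (Function.update x i u) =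
      designMatrix x + vecMulVec u u - vecMulVec (x i) (x i) := by
  unfold designMatrix
  rw [← Finset.add_sum_erase _ _ (Finset.mem_univ i),
    ← Finset.add_sum_erase _ (fun j => vecMulVec (x j) (x j)) (Finset.mem_univ i),
    Function.update_self, Finset.sum_congr rfl fun j hj => by
      rw [Function.update_of_ne (Finset.ne_of_mem_erase hj)]]
  abel

variable [Fintype n]

theorem designMatrix_posDef {x : ι → n → ℝ} (hx : Submodule.span ℝ (Set.range x) = ⊤) :
    (designMatrix x).PosDef := by
  have hinj : Function.Injective (Matrix.of x).mulVec := by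
    refine (injective_iff_map_eq_zero (Matrix.of x).mulVecLin).2 fun v hv => ?_
    have key : ∀ w ∈ Submodule.span ℝ (Set.range x), w ⬝ᵥ v = 0 := by
      intro w hw
      induction hw using Submodule.span_induction with
      | mem w hw =>
        obtain ⟨i, rfl⟩ := hw
        exact congrFun hv i
      | zero => simp
      | add a b _ _ ha hb => simp [add_dotProduct, ha, hb]
      | smul c a _ ha => simp [smul_dotProduct, ha]
    exact dotProduct_self_eq_zero.1 (key v (hx ▸ Submodule.mem_top))
  have h := PosDef.conjTranspose_mul_self (Matrix.of x) hinj
  rwa [conjTranspose_eq_transpose_of_trivial, ← designMatrix_eq_transpose_mul] at h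

variable [DecidableEq n]

/-- Determinant of a rank-two exchange. -/
theorem det_add_vecMulVec_sub_vecMulVec {G : Matrix n n ℝ} (hG : IsUnit G.det) (u v : n → ℝ) :
    (G + vecMulVec u u - vecMulVec v v).det =
      G.det * ((1 + u ⬝ᵥ (G⁻¹ *ᵥ u)) * (1 - v ⬝ᵥ (G⁻¹ *ᵥ v)) +
        (u ⬝ᵥ (G⁻¹ *ᵥ v)) * (v ⬝ᵥ (G⁻¹ *ᵥ u))) := by
  have hUV : G + vecMulVec u u - vecMulVec v v =
      G + (Matrix.of ![u, v])ᵀ * Matrix.of ![u, -v] := by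
    ext a b
    simp [vecMulVec_apply, Matrix.mul_apply, Fin.sum_univ_two]
    ring
  have entry (p q : Fin 2 → n → ℝ) (i j : Fin 2) :
      (Matrix.of p * G⁻¹ * (Matrix.of q)ᵀ) i j = p i ⬝ᵥ (G⁻¹ *ᵥ q j) := by
    rw [Matrix.mul_assoc]
    rfl
  rw [hUV, det_add_mul _ _ hG, det_fin_two]
  simp only [Matrix.add_apply, entry]
  congr 1
  simp [← sub_eq_add_neg]

theorem sum_dotProduct_inv_designMatrix {x : ι → n → ℝ} (hG : IsUnit (designMatrix x).det) :
    ∑ i, x i ⬝ᵥ ((designMatrix x)⁻¹ *ᵥ x i) = Fintype.card n := by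
  have key (H : Matrix n n ℝ) : ∑ i, x i ⬝ᵥ (H *ᵥ x i) = (H * designMatrix x).trace := by
    rw [designMatrix, Matrix.mul_sum, trace_sum]
    refine Finset.sum_congr rfl fun i _ => ?_
    rw [mul_vecMulVec, trace_vecMulVec, dotProduct_comm]
  rw [key, nonsing_inv_mul _ hG, trace_one]

theorem sum_mul_dotProduct_inv_designMatrix {x : ι → n → ℝ} (hG : IsUnit (designMatrix x).det)
    (u : n → ℝ) :
    ∑ i, (u ⬝ᵥ ((designMatrix x)⁻¹ *ᵥ x i)) * (x i ⬝ᵥ ((designMatrix x)⁻¹ *ᵥ u)) =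
      u ⬝ᵥ ((designMatrix x)⁻¹ *ᵥ u) := by
  have key (H : Matrix n n ℝ) (w : n → ℝ) :
      ∑ i, (u ⬝ᵥ (H *ᵥ x i)) * (x i ⬝ᵥ w) = u ⬝ᵥ (H *ᵥ (designMatrix x *ᵥ w)) := by
    rw [designMatrix, Matrix.sum_mulVec, mulVec_sum, dotProduct_sum]
    refine Finset.sum_congr rfl fun i _ => ?_
    rw [vecMulVec_mulVec]
    simp [mulVec_smul, mul_comm]
  rw [key, mulVec_mulVec, mulVec_mulVec, nonsing_inv_mul _ hG, Matrix.one_mul]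

/-- If no single exchange with `u` increases the determinant, then the leverage of `u` is
at most `|n| / (|ι| - |n| + 1)`. -/
theorem leverage_le_of_exchange [DecidableEq ι] {x : ι → n → ℝ} (hG : 0 < (designMatrix x).det)
    {u : n → ℝ}
    (hu : ∀ i, (designMatrix (Function.update x i u)).det ≤ (designMatrix x).det) :
    ((Fintype.card ι : ℝ) - Fintype.card n + 1) * (u ⬝ᵥ ((designMatrix x)⁻¹ *ᵥ u)) ≤
      Fintype.card n := by
  have hunit : IsUnit (designMatrix x).det := hG.ne'.isUnit
  have hle (i : ι) : (1 + u ⬝ᵥ ((designMatrix x)⁻¹ *ᵥ u)) *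
        (1 - x i ⬝ᵥ ((designMatrix x)⁻¹ *ᵥ x i)) +
      (u ⬝ᵥ ((designMatrix x)⁻¹ *ᵥ x i)) * (x i ⬝ᵥ ((designMatrix x)⁻¹ *ᵥ u)) ≤ 1 := by
    have h := hu i
    rw [designMatrix_update, det_add_vecMulVec_sub_vecMulVec hunit] at h
    exact (mul_le_iff_le_one_right hG).1 h
  have hsum := Finset.sum_le_sum fun i (_ : i ∈ Finset.univ) => hle i
  rw [Finset.sum_add_distrib, ← Finset.mul_sum, Finset.sum_sub_distrib,
    sum_dotProduct_inv_designMatrix hunit, sum_mul_dotProduct_inv_designMatrix hunit] at hsum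
  simp only [Finset.sum_const, Finset.card_univ, nsmul_eq_mul, mul_one] at hsum
  linarith

/-- A D-optimal exact design exists on a compact spanning set. -/
theorem exists_isMaxOn_det_designMatrix {K : Set (n → ℝ)} (hK : IsCompact K)
    (hspan : Submodule.span ℝ K = ⊤) (e : ι → n) (he : Function.Surjective e) :
    ∃ x : ι → n → ℝ, (∀ i, x i ∈ K) ∧ 0 < (designMatrix x).det ∧
      ∀ y : ι → n → ℝ, (∀ i, y i ∈ K) → (designMatrix y).det ≤ (designMatrix x).det := by
  obtain ⟨b, hbK, hbspan, -⟩ := Submodule.exists_fun_fin_finrank_span_eq ℝ K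
  have hcard : Module.finrank ℝ (Submodule.span ℝ K) = Fintype.card n := by
    rw [hspan, finrank_top, Module.finrank_fintype_fun_eq_card]
  let σ : n ≃ Fin (Module.finrank ℝ (Submodule.span ℝ K)) := Fintype.equivFinOfCardEq hcard.symm
  have hcont : Continuous fun x : ι → n → ℝ => (designMatrix x).det := by
    unfold designMatrix
    fun_prop
  have hmem : b ∘ σ ∘ e ∈ Set.univ.pi fun _ : ι => K := fun i _ => hbK _
  obtain ⟨x, hxK, hx⟩ := (isCompact_univ_pi fun _ : ι => hK).exists_isMaxOn ⟨_, hmem⟩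
    hcont.continuousOn
  refine ⟨x, fun i => hxK i trivial, ?_, fun y hy => hx fun i _ => hy i⟩
  refine lt_of_lt_of_le (designMatrix_posDef ?_).det_pos (hx hmem)
  rw [(σ.surjective.comp he).range_comp, hbspan, hspan]

end DesignMatrix

theorem two_mul_le_loglog_bound (d : ℕ) :
    (2 * d : ℝ) ≤ 4 * d * Real.log (Real.log (d + 4)) + 28 := by
  have hd0 : (0 : ℝ) ≤ d := d.cast_nonneg
  have hexp : Real.exp 1 < 2.7182818286 := Real.exp_one_lt_d9
  rcases le_or_gt d 14 with h | h
  · have h1 : 1 ≤ Real.log (d + 4) := by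
      rw [Real.le_log_iff_exp_le (by positivity)]
      linarith
    have h2 := mul_nonneg hd0 (Real.log_nonneg h1)
    have h3 : (d : ℝ) ≤ 14 := by exact_mod_cast h
    linarith
  · have h3 : (14 : ℝ) ≤ d := by exact_mod_cast h.le
    have h1 : 2 ≤ Real.log (d + 4) := by
      rw [Real.le_log_iff_exp_le (by positivity), show (2 : ℝ) = 1 + 1 by norm_num, Real.exp_add]
      nlinarith [Real.exp_pos 1]
    have h2 : (1 / 2 : ℝ) ≤ Real.log (Real.log (d + 4)) :=
      le_trans (by linarith [Real.log_two_gt_d9]) (Real.log_le_log two_pos h1)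
    nlinarith

/-- Weighted Kiefer–Wolfowitz theorem (Theorem 4.1): if the weighted feature set
`Φ_f = { φ(s)/f(s) : s ∈ S }` is compact and spans `ℝ^d`, there is a design `ρ_f` with
finite support of size at most `4d·log(log(d+4)) + 28` whose weighted design matrix `G_f`
is invertible and satisfies `g_f(ρ_f) ≤ 2d`. -/
theorem weighted_kiefer_wolfowitz
    (d : ℕ) (hd : 1 ≤ d) {S : Type*} (φ : S → Fin d → ℝ) (f : S → ℝ)
    (hf : ∀ s, 0 < f s)
    (hcompact : IsCompact {v : Fin d → ℝ | ∃ s : S, v = (f s)⁻¹ • φ s})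
    (hspan : Submodule.span ℝ {v : Fin d → ℝ | ∃ s : S, v = (f s)⁻¹ • φ s} = ⊤) :
    ∃ (C : Finset S) (ρ : S → ℝ),
      (C.card : ℝ) ≤ 4 * d * Real.log (Real.log (d + 4)) + 28 ∧
      (∀ y ∈ C, 0 < ρ y) ∧
      (∀ y ∉ C, ρ y = 0) ∧
      ∑ y ∈ C, ρ y = 1 ∧
      IsUnit (∑ y ∈ C, (ρ y / f y ^ 2) • vecMulVec (φ y) (φ y)) ∧
      ∀ s : S,
        φ s ⬝ᵥ ((∑ y ∈ C, (ρ y / f y ^ 2) • vecMulVec (φ y) (φ y))⁻¹ *ᵥ φ s) / f s ^ 2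
          ≤ 2 * d := by
  classical
  obtain ⟨x, hxK, hdet, hmax⟩ := exists_isMaxOn_det_designMatrix hcompact hspan
    (Sum.elim id id : Fin d ⊕ Fin d → Fin d) fun i => ⟨Sum.inl i, rfl⟩
  choose t ht using hxK
  have hd0 : (0 : ℝ) < d := by exact_mod_cast hd
  set m : ℝ := 2 * d with hm
  have hm0 : 0 < m := by positivity
  have hcard : (Fintype.card (Fin d ⊕ Fin d) : ℝ) = m := by
    simp [hm, two_mul]
  let ρ : S → ℝ := fun y => (Finset.univ.filter fun i => t i = y).card / m
  have hG : ∑ y ∈ Finset.univ.image t, (ρ y / f y ^ 2) • vecMulVec (φ y) (φ y) =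
      m⁻¹ • designMatrix x := by
    have h := Finset.sum_comp (s := Finset.univ)
      (fun y => vecMulVec ((f y)⁻¹ • φ y) ((f y)⁻¹ • φ y)) t
    simp only [← ht] at h
    rw [designMatrix, h, Finset.smul_sum]
    refine Finset.sum_congr rfl fun y _ => ?_
    rw [smul_vecMulVec, vecMulVec_smul, ← Nat.cast_smul_eq_nsmul ℝ, smul_smul, smul_smul, smul_smul]
    congr 1
    simp only [ρ]
    field_simp
  have hunit : IsUnit (designMatrix x).det := hdet.ne'.isUnit
  have hinv : (m⁻¹ • designMatrix x)⁻¹ = m • (designMatrix x)⁻¹ := by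
    refine inv_eq_left_inv ?_
    rw [smul_mul_smul_comm, mul_inv_cancel₀ hm0.ne', one_smul, nonsing_inv_mul _ hunit]
  refine ⟨Finset.univ.image t, ρ, ?_, ?_, ?_, ?_, ?_, fun s => ?_⟩
  · have h : ((Finset.univ.image t).card : ℝ) ≤ m := by
      rw [← hcard]
      exact_mod_cast Finset.card_image_le
    exact h.trans (two_mul_le_loglog_bound d)
  · intro y hy
    obtain ⟨i, -, rfl⟩ := Finset.mem_image.1 hy
    refine div_pos ?_ hm0
    exact_mod_cast Finset.card_pos.2 ⟨i, by simp⟩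
  · intro y hy
    have h : (Finset.univ.filter fun i => t i = y) = ∅ :=
      Finset.filter_eq_empty_iff.2 fun i _ hi =>
        hy (Finset.mem_image.2 ⟨i, Finset.mem_univ _, hi⟩)
    simp [ρ, h]
  · simp only [ρ]
    rw [← Finset.sum_div, ← Nat.cast_sum, ← Finset.card_eq_sum_card_image, Finset.card_univ, hcard,
      div_self hm0.ne']
  · rw [hG, isUnit_iff_isUnit_det, det_smul]
    exact ((pow_pos (inv_pos.2 hm0) _).ne'.isUnit).mul hunit
  · have hle := leverage_le_of_exchange hdet (u := (f s)⁻¹ • φ s) fun i => hmax _ fun j => by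
      rcases eq_or_ne j i with rfl | hj
      · exact ⟨s, by simp⟩
      · exact ⟨t j, by rw [Function.update_of_ne hj, ht]⟩
    rw [hcard, Fintype.card_fin] at hle
    have hscale : φ s ⬝ᵥ ((m⁻¹ • designMatrix x)⁻¹ *ᵥ φ s) / f s ^ 2 =
        m * (((f s)⁻¹ • φ s) ⬝ᵥ ((designMatrix x)⁻¹ *ᵥ ((f s)⁻¹ • φ s))) := by
      have := (hf s).ne'
      rw [hinv, smul_mulVec, mulVec_smul, dotProduct_smul, dotProduct_smul, smul_dotProduct]
      simp only [smul_eq_mul]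
      field_simp
    rw [hG, hscale]
    nlinarith
end

section
/- Let d ≥ 1, S a set, φ : S → ℝ^d, f : S → (0,∞), C ⊆ S a finite set, and ρ a probability distribution on S supported on C, such that the weighted design matrix G_f = ∑_{y ∈ C} ρ(y) φ(y)φ(y)ᵀ / f(y)² is invertible and sup_{s ∈ S} φ(s)ᵀ G_f⁻¹ φ(s) / f(s)² ≤ 2d. Then for every function z : C → ℝ and every s ∈ S, |φ(s)ᵀ Λ(f,z)| ≤ √(2d) · f(s) · max_{y ∈ C} |z(y)/f(y)|, where Λ(f,z) := G_f⁻¹ ∑_{y ∈ C} ρ(y) φ(y) z(y) / f(y)². -/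
open Matrix

/-- The quadratic form of a weighted design matrix is a weighted sum of squares. -/
theorem dotProduct_sum_smul_vecMulVec_mulVec {n S : Type*} [Fintype n] (φ : S → n → ℝ)
    (C : Finset S) (w : S → ℝ) (u : n → ℝ) :
    u ⬝ᵥ ((∑ y ∈ C, w y • vecMulVec (φ y) (φ y)) *ᵥ u) = ∑ y ∈ C, w y * (u ⬝ᵥ φ y) ^ 2 := by
  rw [sum_mulVec, dotProduct_sum]
  refine Finset.sum_congr rfl fun y _ => ?_
  rw [smul_mulVec, vecMulVec_mulVec, dotProduct_smul, dotProduct_smul, dotProduct_comm (φ y) u]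
  simp only [smul_eq_mul, MulOpposite.smul_eq_mul_unop, MulOpposite.unop_op]
  ring

/-- The design matrix is symmetric. -/
theorem isSymm_sum_smul_vecMulVec {n S : Type*} (φ : S → n → ℝ) (C : Finset S) (w : S → ℝ) :
    (∑ y ∈ C, w y • vecMulVec (φ y) (φ y)).IsSymm := by
  simp [Matrix.IsSymm, transpose_sum, transpose_smul, transpose_vecMulVec]

/-- A weighted average of `a * b` is at most `sup |b|` times the weighted quadratic mean of `a`. -/
theorem abs_sum_mul_mul_le_sqrt_mul {S : Type*} (C : Finset S) (ρ a b : S → ℝ) {M : ℝ}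
    (hρnn : ∀ y ∈ C, 0 ≤ ρ y) (hρ1 : ∑ y ∈ C, ρ y = 1) (hM : ∀ y ∈ C, |b y| ≤ M) :
    |∑ y ∈ C, ρ y * a y * b y| ≤ √(∑ y ∈ C, ρ y * a y ^ 2) * M := by
  have hM0 : 0 ≤ M := by
    obtain ⟨y, hy⟩ : C.Nonempty := by
      rw [Finset.nonempty_iff_ne_empty]
      rintro rfl
      simp at hρ1
    exact (abs_nonneg _).trans (hM y hy)
  have hmean : ∑ y ∈ C, ρ y * |a y| ≤ √(∑ y ∈ C, ρ y * a y ^ 2) := by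
    refine Real.le_sqrt_of_sq_le ?_
    have h := Finset.sum_sq_le_sum_mul_sum_of_sq_le_mul C (r := fun y => ρ y * |a y|) (f := ρ)
      (g := fun y => ρ y * a y ^ 2) hρnn (fun y hy => mul_nonneg (hρnn y hy) (sq_nonneg _))
      (fun y _ => by rw [mul_pow, sq_abs, pow_two (ρ y), mul_assoc])
    rwa [hρ1, one_mul] at h
  calc |∑ y ∈ C, ρ y * a y * b y| ≤ ∑ y ∈ C, |ρ y * a y * b y| := Finset.abs_sum_le_sum_abs _ _
    _ ≤ ∑ y ∈ C, ρ y * |a y| * M := by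
        refine Finset.sum_le_sum fun y hy => ?_
        rw [abs_mul, abs_mul, abs_of_nonneg (hρnn y hy)]
        exact mul_le_mul_of_nonneg_left (hM y hy) (mul_nonneg (hρnn y hy) (abs_nonneg _))
    _ = (∑ y ∈ C, ρ y * |a y|) * M := (Finset.sum_mul _ _ _).symm
    _ ≤ _ := mul_le_mul_of_nonneg_right hmean hM0

/-- Weighted Kiefer–Wolfowitz bound (Lemma 4.2): if the weighted design matrix `G_f` is
invertible and `sup_s φ(s)ᵀ G_f⁻¹ φ(s)/f(s)² ≤ 2d`, then the weighted least-squares solution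
`Λ(f,z) = G_f⁻¹ ∑_{y∈C} ρ(y) φ(y) z(y)/f(y)²` satisfies
`|φ(s)ᵀ Λ(f,z)| ≤ √(2d)·f(s)·max_{y∈C} |z(y)/f(y)|` for all `s`. -/
theorem weighted_kw_bound
    (d : ℕ) (hd : 1 ≤ d) {S : Type*} (φ : S → Fin d → ℝ) (f : S → ℝ)
    (hf : ∀ s, 0 < f s)
    (C : Finset S) (ρ : S → ℝ)
    (hρnn : ∀ y ∈ C, 0 ≤ ρ y) (hρ1 : ∑ y ∈ C, ρ y = 1)
    (G : Matrix (Fin d) (Fin d) ℝ)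
    (hG : G = ∑ y ∈ C, (ρ y / f y ^ 2) • vecMulVec (φ y) (φ y))
    (hGunit : IsUnit G)
    (hdesign : ∀ s : S, φ s ⬝ᵥ (G⁻¹ *ᵥ φ s) / f s ^ 2 ≤ 2 * d) :
    ∀ (z : S → ℝ) (s : S),
      |φ s ⬝ᵥ (G⁻¹ *ᵥ (∑ y ∈ C, (ρ y * z y / f y ^ 2) • φ y))| ≤
        Real.sqrt (2 * d) * f s * sSup ((fun y => |z y / f y|) '' ↑C) := by
  intro z s
  set u := G⁻¹ *ᵥ φ s with hu
  have hdet : IsUnit G.det := (isUnit_iff_isUnit_det G).1 hGunit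
  have hsymm : G⁻¹ᵀ = G⁻¹ := by
    rw [transpose_nonsing_inv, hG, (isSymm_sum_smul_vecMulVec φ C _).eq]
  have hquad : ∑ y ∈ C, ρ y * ((u ⬝ᵥ φ y) / f y) ^ 2 = φ s ⬝ᵥ u := by
    have hGu : G *ᵥ u = φ s := by
      rw [hu, mulVec_mulVec, mul_nonsing_inv G hdet, one_mulVec]
    rw [dotProduct_comm (φ s) u, ← hGu, hG, dotProduct_sum_smul_vecMulVec_mulVec]
    exact Finset.sum_congr rfl fun y _ => by ring
  have hpred : φ s ⬝ᵥ (G⁻¹ *ᵥ (∑ y ∈ C, (ρ y * z y / f y ^ 2) • φ y)) =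
      ∑ y ∈ C, ρ y * ((u ⬝ᵥ φ y) / f y) * (z y / f y) := by
    rw [dotProduct_mulVec, ← mulVec_transpose, hsymm, ← hu, dotProduct_sum]
    refine Finset.sum_congr rfl fun y _ => ?_
    rw [dotProduct_smul, smul_eq_mul]
    ring
  have hM : ∀ y ∈ C, |z y / f y| ≤ sSup ((fun y => |z y / f y|) '' ↑C) := fun y hy =>
    le_csSup (C.finite_toSet.image _).bddAbove ⟨y, hy, rfl⟩
  have hsqrt : √(φ s ⬝ᵥ u) ≤ √(2 * d) * f s := by
    rw [← Real.sqrt_sq (hf s).le, ← Real.sqrt_mul (by positivity)]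
    exact Real.sqrt_le_sqrt ((div_le_iff₀ (pow_pos (hf s) 2)).1 (hdesign s))
  rw [hpred]
  refine (abs_sum_mul_mul_le_sqrt_mul C ρ _ _ hρnn hρ1 hM).trans ?_
  rw [hquad]
  refine mul_le_mul_of_nonneg_right hsqrt (Real.sSup_nonneg ?_)
  rintro _ ⟨y, -, rfl⟩
  exact abs_nonneg _
end

section
/- Let X be a finite nonempty set, γ ∈ [0,1), H = 1/(1−γ), and k ≥ 1. For j = 0,…,k−1 let P_j be a row-stochastic X×X matrix, acting on v : X → ℝ by (P_j v)(x) = ∑_y P_j(x,y) v(y); for i ≥ j write P_j^i := P_i P_{i−1} ⋯ P_j, and P_j^i := Id for i < j. Suppose functions Σ²_0,…,Σ²_k : X → [0,∞) and σ²_1,…,σ²_k : X → [0,∞) satisfy Σ²_j = γ² σ²_j + γ² P_{j−1} Σ²_{j−1} pointwise for all j ∈ {1,…,k}, and Σ²_j ≤ H² pointwise for all j ∈ {0,…,k}. Then, writing σ_j := √(σ²_j) pointwise, ∑_{j=0}^{k−1} γ^{j+1} (P_{k−j}^{k−1} σ_{k−j})(x) ≤ √(2H³) for every x ∈ X. -/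
open Finset Matrix

/-- `matProdN P i n = P_i * P_{i−1} * ⋯ * P_{i−n+1}` (`n` factors; the identity if `n = 0`),
so that for `i ≥ j` the paper's `P_j^i` is `matProdN P i (i + 1 - j)`. -/
noncomputable def matProdN {X : Type*} [Fintype X] [DecidableEq X]
    (P : ℕ → Matrix X X ℝ) (i n : ℕ) : Matrix X X ℝ :=
  ((List.range n).map (fun t => P (i - t))).prod

theorem matProdN_succ {X : Type*} [Fintype X] [DecidableEq X]
    (P : ℕ → Matrix X X ℝ) (i n : ℕ) :
    matProdN P i (n + 1) = P i * matProdN P (i - 1) n := by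
  simp only [matProdN, List.range_succ_eq_map, List.map_cons, List.map_map, List.prod_cons,
    Nat.sub_zero]
  congr 3
  funext t
  simp [Nat.sub_sub, Nat.add_comm]

/-- The discounted sum of the propagated vectors satisfies a Bellman-type recursion. -/
theorem sum_matProdN_mulVec_succ {X : Type*} [Fintype X] [DecidableEq X]
    (γ : ℝ) (P : ℕ → Matrix X X ℝ) (s : ℕ → X → ℝ) (n : ℕ) (x : X) :
    ∑ j ∈ range (n + 1), γ ^ (j + 1) * (matProdN P n j *ᵥ s (n + 1 - j)) x
      = γ * s (n + 1) x + γ * (P n *ᵥ fun y =>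
          ∑ j ∈ range n, γ ^ (j + 1) * (matProdN P (n - 1) j *ᵥ s (n - j)) y) x := by
  have h_fun : (fun y => ∑ j ∈ range n, γ ^ (j + 1) * (matProdN P (n - 1) j *ᵥ s (n - j)) y)
      = ∑ j ∈ range n, γ ^ (j + 1) • (matProdN P (n - 1) j *ᵥ s (n - j)) := by
    ext y
    simp
  rw [h_fun, sum_range_succ', Matrix.mulVec_sum, Finset.sum_apply, Finset.mul_sum, add_comm]
  congr 1
  · simp [matProdN]
  · refine Finset.sum_congr rfl fun j _ => ?_
    rw [matProdN_succ, Matrix.mulVec_smul, Matrix.mulVec_mulVec, Nat.add_sub_add_right,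
      Pi.smul_apply, smul_eq_mul]
    ring

theorem sq_mulVec_le_mulVec_sq {X : Type*} [Fintype X] (A : Matrix X X ℝ) (f : X → ℝ) (x : X)
    (h_nonneg : ∀ y, 0 ≤ A x y) (h_row : ∑ y, A x y = 1) :
    (A *ᵥ f) x ^ 2 ≤ (A *ᵥ fun y => f y ^ 2) x :=
  Real.pow_arith_mean_le_arith_mean_pow_of_even univ (A x) f (fun y _ => h_nonneg y) h_row
    even_two

theorem mulVec_le_mulVec_of_nonneg {X : Type*} [Fintype X] (A : Matrix X X ℝ) {f g : X → ℝ}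
    (x : X) (h_nonneg : ∀ y, 0 ≤ A x y) (hfg : ∀ y, f y ≤ g y) :
    (A *ᵥ f) x ≤ (A *ᵥ g) x :=
  Finset.sum_le_sum fun y _ => mul_le_mul_of_nonneg_left (hfg y) (h_nonneg y)

theorem mulVec_affine {X : Type*} [Fintype X] (A : Matrix X X ℝ) (f : X → ℝ) (a b : ℝ) (x : X)
    (h_row : ∑ y, A x y = 1) :
    (A *ᵥ fun y => a * (f y + b)) x = a * ((A *ᵥ f) x + b) := by
  simp only [Matrix.mulVec, dotProduct]
  calc ∑ y, A x y * (a * (f y + b)) = ∑ y, (a * (A x y * f y) + a * b * A x y) :=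
        Finset.sum_congr rfl fun y _ => by ring
    _ = a * ((∑ y, A x y * f y) + b) := by
        rw [Finset.sum_add_distrib, ← Finset.mul_sum, ← Finset.mul_sum, h_row]
        ring

/-- Total-variance technique (Lemma E.3 / Corollary 3.1): if `Σ²_j = γ²σ²_j + γ²P_{j−1}Σ²_{j−1}`
pointwise and `0 ≤ Σ²_j ≤ H²`, then `∑_{j=0}^{k−1} γ^{j+1} (P_{k−j}^{k−1} σ_{k−j})(x) ≤ √(2H³)`,
where `σ_j = √(σ²_j)` pointwise and `P_{k−j}^{k−1}` is the product of `j` stochastic matrices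
`P_{k−1} ⋯ P_{k−j}` (the identity for `j = 0`). -/
theorem total_variance_technique
    {X : Type*} [Fintype X] [DecidableEq X] [Nonempty X]
    (γ : ℝ) (hγ0 : 0 ≤ γ) (hγ1 : γ < 1)
    (H : ℝ) (hH : H = (1 - γ)⁻¹)
    (k : ℕ) (hk : 1 ≤ k)
    (P : ℕ → Matrix X X ℝ)
    (hPnn : ∀ j < k, ∀ x y, 0 ≤ P j x y)
    (hProw : ∀ j < k, ∀ x, ∑ y, P j x y = 1)
    (Sig2 sig2 : ℕ → X → ℝ)
    (hsig2nn : ∀ j, 1 ≤ j → j ≤ k → ∀ x, 0 ≤ sig2 j x)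
    (hSig2nn : ∀ j ≤ k, ∀ x, 0 ≤ Sig2 j x)
    (hSig2ub : ∀ j ≤ k, ∀ x, Sig2 j x ≤ H ^ 2)
    (hrec : ∀ j, 1 ≤ j → j ≤ k → ∀ x,
      Sig2 j x = γ ^ 2 * sig2 j x + γ ^ 2 * ((P (j - 1)) *ᵥ (Sig2 (j - 1))) x) :
    ∀ x, ∑ j ∈ range k,
        γ ^ (j + 1) * ((matProdN P (k - 1) j) *ᵥ (fun y => Real.sqrt (sig2 (k - j) y))) x
      ≤ Real.sqrt (2 * H ^ 3) := by
  have h1γ : 0 < 1 - γ := sub_pos.2 hγ1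
  have hH0 : 0 < H := hH ▸ inv_pos.2 h1γ
  have hHγ : (1 - γ) * H = 1 := by rw [hH, mul_inv_cancel₀ h1γ.ne']
  have key : ∀ n ≤ k, ∀ x, (∑ j ∈ range n,
      γ ^ (j + 1) * (matProdN P (n - 1) j *ᵥ fun y => Real.sqrt (sig2 (n - j) y)) x) ^ 2
        ≤ H * (Sig2 n x + γ * H ^ 2) := by
    intro n
    induction n with
    | zero =>
      intro hn x
      have := hSig2nn 0 hn x
      rw [Finset.sum_range_zero, zero_pow two_ne_zero]
      positivity
    | succ n ih =>
      intro hn x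
      have hnn := hPnn n hn x
      have hrow := hProw n hn x
      have hF := sum_matProdN_mulVec_succ γ P (fun i y => Real.sqrt (sig2 i y)) n x
      rw [Nat.add_sub_cancel, hF]
      have h_jensen := (sq_mulVec_le_mulVec_sq (P n) _ x hnn hrow).trans
        (mulVec_le_mulVec_of_nonneg (P n) x hnn (ih (Nat.le_of_succ_le hn)))
      rw [mulVec_affine _ _ _ _ _ hrow] at h_jensen
      have h_bound : (P n *ᵥ Sig2 n) x ≤ H ^ 2 := by
        refine (mulVec_le_mulVec_of_nonneg (P n) (g := fun _ => H ^ 2) x hnn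
          (hSig2ub n (Nat.le_of_succ_le hn))).trans_eq ?_
        simp only [Matrix.mulVec, dotProduct]
        rw [← Finset.sum_mul, hrow, one_mul]
      have h_rec := hrec (n + 1) (Nat.le_add_left 1 n) hn x
      rw [Nat.add_sub_cancel] at h_rec
      have h_sqrt := Real.sq_sqrt (hsig2nn (n + 1) (Nat.le_add_left 1 n) hn x)
      generalize (P n *ᵥ fun y => ∑ j ∈ range n, γ ^ (j + 1) *
        (matProdN P (n - 1) j *ᵥ fun y => Real.sqrt (sig2 (n - j) y)) y) x = F at h_jensen ⊢
      generalize (P n *ᵥ Sig2 n) x = v at *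
      generalize Real.sqrt (sig2 (n + 1) x) = s at *
      have h_convex : (γ * s + γ * F) ^ 2 ≤ H * γ ^ 2 * s ^ 2 + γ * F ^ 2 := by
        have h_gap : H * γ ^ 2 * s ^ 2 + γ * F ^ 2 - (γ * s + γ * F) ^ 2
            = γ * (1 - γ) * (H * γ * s - F) ^ 2 := by
          linear_combination (γ ^ 2 * s ^ 2 * (1 - γ * H) + 2 * γ ^ 2 * s * F) * hHγ
        have : 0 ≤ γ * (1 - γ) * (H * γ * s - F) ^ 2 := by positivity
        linarith
      calc (γ * s + γ * F) ^ 2 ≤ H * γ ^ 2 * s ^ 2 + γ * F ^ 2 := h_convex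
        _ ≤ H * γ ^ 2 * s ^ 2 + γ * (H * (v + γ * H ^ 2)) := by gcongr
        _ = H * (Sig2 (n + 1) x + γ * (1 - γ) * v + γ ^ 2 * H ^ 2) := by
            rw [h_rec, h_sqrt]; ring
        _ ≤ H * (Sig2 (n + 1) x + γ * (1 - γ) * H ^ 2 + γ ^ 2 * H ^ 2) := by gcongr
        _ = H * (Sig2 (n + 1) x + γ * H ^ 2) := by ring
  intro x
  refine Real.le_sqrt_of_sq_le ((key k le_rfl x).trans ?_)
  calc H * (Sig2 k x + γ * H ^ 2) ≤ H * (H ^ 2 + 1 * H ^ 2) := by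
        gcongr
        exact hSig2ub k le_rfl x
    _ = 2 * H ^ 3 := by ring
end

section
/- Under the MDVI recursion with errors described in the context, for every k ∈ {1,…,K}: 0 ≤ v_* − v_{π'_k} ≤ Γ_k pointwise on X, where Γ_k := (1/A_∞) ∑_{j=0}^{k−1} γ^j ( π_k P_{k−j}^{k−1} − π_* P_*^j ) ê_{k−j} + 2H ( α^k + A_{γ,k}/A_∞ ) · 1. -/
open Finset

noncomputable section

/-- `(Pq v)(x,a) = ∑_y P(y|x,a) v(y)`, the operator `P : F_v → F_q`. -/
def appP {X A : Type*} [Fintype X] (P : X → A → X → ℝ) (v : X → ℝ) : X → A → ℝ :=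
  fun x a => ∑ y, P x a y * v y

/-- `(π q)(x) = ∑_a π(a|x) q(x,a)`, the operator `π : F_q → F_v`. -/
def appPol {X A : Type*} [Fintype A] (pol : X → A → ℝ) (q : X → A → ℝ) : X → ℝ :=
  fun x => ∑ a, pol x a * q x a

/-- `P_π q = P (π q)`, the operator `P_π : F_q → F_q`. -/
def Ppol {X A : Type*} [Fintype X] [Fintype A] (P : X → A → X → ℝ) (pol : X → A → ℝ)
    (q : X → A → ℝ) : X → A → ℝ :=
  appP P (appPol pol q)

/-- Bellman operator `T_π q = r + γ P_π q`. -/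
def bellmanOp {X A : Type*} [Fintype X] [Fintype A] (γ : ℝ) (r : X → A → ℝ)
    (P : X → A → X → ℝ) (pol : X → A → ℝ) (q : X → A → ℝ) : X → A → ℝ :=
  fun x a => r x a + γ * Ppol P pol q x a

/-- `PpolProdN P πs i n = P_{π_i} P_{π_{i−1}} ⋯ P_{π_{i−n+1}}` (`n` factors; the identity
for `n = 0`), so that for `i ≥ j` the paper's `P_j^i` is `PpolProdN P πs i (i + 1 − j)`. -/
def PpolProdN {X A : Type*} [Fintype X] [Fintype A] (P : X → A → X → ℝ)
    (πs : ℕ → X → A → ℝ) (i n : ℕ) (q : X → A → ℝ) : X → A → ℝ :=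
  (((List.range n).map (fun t => Ppol P (πs (i - t)))).foldr (· ∘ ·) id) q

/-- `bellmanComp γ r P πs k = T_{π_{k−1}} ∘ ⋯ ∘ T_{π_1}` (the identity for `k ≤ 1`), so that
`v_{π'_k} = π_k (bellmanComp γ r P πs k q_{π_0})`. -/
def bellmanComp {X A : Type*} [Fintype X] [Fintype A] (γ : ℝ) (r : X → A → ℝ)
    (P : X → A → X → ℝ) (πs : ℕ → X → A → ℝ) (k : ℕ) (q : X → A → ℝ) : X → A → ℝ :=
  (((List.range (k - 1)).map (fun t => bellmanOp γ r P (πs (k - 1 - t)))).foldr (· ∘ ·) id) q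

/-- `π` is a policy: `π(·|x)` is a probability distribution over actions for each state. -/
def IsPolicy {X A : Type*} [Fintype A] (pol : X → A → ℝ) : Prop :=
  (∀ x a, 0 ≤ pol x a) ∧ ∀ x, ∑ a, pol x a = 1

/-- `π` is greedy with respect to `s`: `π(·|x)` is supported on `argmax_a s(x,a)`. -/
def IsGreedy {X A : Type*} (pol : X → A → ℝ) (s : X → A → ℝ) : Prop :=
  ∀ x a, pol x a ≠ 0 → ∀ b, s x b ≤ s x a

end

section StateOperators

variable {X A : Type*} [Fintype X] {P : X → A → X → ℝ}

theorem appP_mono (hP : ∀ x a y, 0 ≤ P x a y) {v v' : X → ℝ} (h : ∀ y, v y ≤ v' y) (x : X)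
    (a : A) : appP P v x a ≤ appP P v' x a :=
  sum_le_sum fun y _ => mul_le_mul_of_nonneg_left (h y) (hP x a y)

theorem appP_add_const (hP : ∀ x a, ∑ y, P x a y = 1) (v : X → ℝ) (c : ℝ) (x : X) (a : A) :
    appP P (fun y => v y + c) x a = appP P v x a + c := by
  simp [appP, mul_add, sum_add_distrib, ← sum_mul, hP]

theorem appP_sub (v v' : X → ℝ) (x : X) (a : A) :
    appP P (fun y => v y - v' y) x a = appP P v x a - appP P v' x a := by
  simp [appP, mul_sub]

theorem appP_const_mul (c : ℝ) (v : X → ℝ) (x : X) (a : A) :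
    appP P (fun y => c * v y) x a = c * appP P v x a := by
  simp [appP, mul_sum, mul_left_comm]

end StateOperators

section PolicyOperators

variable {X A : Type*} [Fintype A] {pol : X → A → ℝ}

theorem appPol_mono (hpol : IsPolicy pol) {q q' : X → A → ℝ} (x : X)
    (h : ∀ a, q x a ≤ q' x a) : appPol pol q x ≤ appPol pol q' x :=
  sum_le_sum fun a _ => mul_le_mul_of_nonneg_left (h a) (hpol.1 x a)

theorem appPol_add_const (hpol : IsPolicy pol) (q : X → A → ℝ) (c : ℝ) (x : X) :
    appPol pol (fun x a => q x a + c) x = appPol pol q x + c := by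
  simp [appPol, mul_add, sum_add_distrib, ← sum_mul, hpol.2]

theorem appPol_sub (q q' : X → A → ℝ) (x : X) :
    appPol pol (fun x a => q x a - q' x a) x = appPol pol q x - appPol pol q' x := by
  simp [appPol, mul_sub]

theorem appPol_const_mul (c : ℝ) (q : X → A → ℝ) (x : X) :
    appPol pol (fun x a => c * q x a) x = c * appPol pol q x := by
  simp [appPol, mul_sum, mul_left_comm]

theorem appPol_sum (n : ℕ) (c : ℕ → ℝ) (f : ℕ → X → A → ℝ) (x : X) :
    appPol pol (fun x a => ∑ j ∈ range n, c j * f j x a) x =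
      ∑ j ∈ range n, c j * appPol pol (f j) x := by
  simp only [appPol, mul_sum]
  rw [sum_comm]
  simp only [mul_left_comm]

theorem appPol_le_const (hpol : IsPolicy pol) {q : X → A → ℝ} {c : ℝ} (x : X)
    (h : ∀ a, q x a ≤ c) : appPol pol q x ≤ c := by
  have := appPol_mono hpol (q' := fun _ _ => c) x h
  simpa [appPol, ← sum_mul, hpol.2] using this

theorem IsGreedy.appPol_eq_sup' [Nonempty A] (hpol : IsPolicy pol) {s : X → A → ℝ}
    (h : IsGreedy pol s) (x : X) :
    appPol pol s x = univ.sup' univ_nonempty (fun a => s x a) := by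
  have hterm : ∀ a, pol x a * s x a = pol x a * univ.sup' univ_nonempty (fun a => s x a) := by
    intro a
    by_cases ha : pol x a = 0
    · simp [ha]
    · rw [le_antisymm (le_sup' (fun a => s x a) (mem_univ a)) (sup'_le _ _ fun b _ => h x a ha b)]
  simp only [appPol, hterm, ← sum_mul, hpol.2, one_mul]

theorem appPol_le_sup' [Nonempty A] (hpol : IsPolicy pol) (s : X → A → ℝ) (x : X) :
    appPol pol s x ≤ univ.sup' univ_nonempty (fun a => s x a) :=
  appPol_le_const hpol x fun a => le_sup' (fun a => s x a) (mem_univ a)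

end PolicyOperators

section Operators

variable {X A : Type*} [Fintype X] [Fintype A] {P : X → A → X → ℝ} {pol : X → A → ℝ}

theorem Ppol_sum (n : ℕ) (c : ℕ → ℝ) (f : ℕ → X → A → ℝ) (x : X) (a : A) :
    Ppol P pol (fun x a => ∑ j ∈ range n, c j * f j x a) x a =
      ∑ j ∈ range n, c j * Ppol P pol (f j) x a := by
  simp only [Ppol, appP, appPol_sum, mul_sum]
  rw [sum_comm]
  simp only [mul_left_comm]

theorem Ppol_sub (q q' : X → A → ℝ) (x : X) (a : A) :
    Ppol P pol (fun x a => q x a - q' x a) x a = Ppol P pol q x a - Ppol P pol q' x a := by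
  simp only [Ppol, funext (appPol_sub (pol := pol) q q'), appP_sub]

theorem Ppol_neg (q : X → A → ℝ) (x : X) (a : A) :
    Ppol P pol (fun x a => -q x a) x a = -Ppol P pol q x a := by
  simp [Ppol, appP, appPol]

theorem Ppol_le_const (hP : ∀ x a y, 0 ≤ P x a y) (hP1 : ∀ x a, ∑ y, P x a y = 1)
    (hpol : IsPolicy pol) {q : X → A → ℝ} {c : ℝ} (h : ∀ x a, q x a ≤ c) (x : X) (a : A) :
    Ppol P pol q x a ≤ c := by
  have := appP_mono hP (v' := fun _ => c) (fun y => appPol_le_const hpol y (h y)) x a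
  simpa [Ppol, appP, ← sum_mul, hP1] using this

/-- A discounted recursive inequality forces a uniform upper bound. -/
theorem le_of_le_add_discount_Ppol {γ : ℝ} (hγ0 : 0 ≤ γ) (hγ1 : γ < 1)
    (hP : ∀ x a y, 0 ≤ P x a y) (hP1 : ∀ x a, ∑ y, P x a y = 1) (hpol : IsPolicy pol)
    {d : X → A → ℝ} {c : ℝ} (h : ∀ x a, d x a ≤ c + γ * Ppol P pol d x a) (x : X) (a : A) :
    d x a ≤ (1 - γ)⁻¹ * c := by
  have : Nonempty (X × A) := ⟨(x, a)⟩
  obtain ⟨z, hz⟩ := Finite.exists_max fun z : X × A => d z.1 z.2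
  have hPd := Ppol_le_const hP hP1 hpol (fun x a => hz (x, a)) z.1 z.2
  have hmax : (1 - γ) * d z.1 z.2 ≤ c := by
    linarith [h z.1 z.2, mul_le_mul_of_nonneg_left hPd hγ0]
  refine (hz (x, a)).trans ?_
  rw [inv_mul_eq_div, le_div_iff₀ (sub_pos.mpr hγ1)]
  linarith

theorem PpolProdN_succ (πs : ℕ → X → A → ℝ) (i n : ℕ) (q : X → A → ℝ) :
    PpolProdN P πs i (n + 1) q = Ppol P (πs i) (PpolProdN P πs (i - 1) n q) := by
  simp [PpolProdN, List.range_succ_eq_map, Function.comp_def, Nat.sub_sub, Nat.add_comm]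

theorem PpolProdN_const (i n : ℕ) (q : X → A → ℝ) :
    PpolProdN P (fun _ => pol) i n q = (Ppol P pol)^[n] q := by
  induction n generalizing i with
  | zero => rfl
  | succ n ih => rw [PpolProdN_succ, ih, Function.iterate_succ_apply']

theorem bellmanComp_succ {γ : ℝ} {r : X → A → ℝ} {πs : ℕ → X → A → ℝ} {q : X → A → ℝ}
    (hq : q = bellmanOp γ r P (πs 0) q) (k : ℕ) :
    bellmanComp γ r P πs (k + 1) q = bellmanOp γ r P (πs k) (bellmanComp γ r P πs k q) := by
  cases k with
  | zero => exact hq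
  | succ k =>
    simp [bellmanComp, List.range_succ_eq_map, Function.comp_def, Nat.add_comm]

/-- The discounted error accumulated after `k` steps along the policies `πs`. -/
noncomputable def discountedError (γ : ℝ) (P : X → A → X → ℝ) (πs e : ℕ → X → A → ℝ) (k : ℕ) :
    X → A → ℝ :=
  fun x a => ∑ j ∈ range k, γ ^ j * PpolProdN P πs (k - 1) j (e (k - j)) x a

theorem appPol_discountedError_zero (γ : ℝ) (πs e : ℕ → X → A → ℝ) (x : X) :
    appPol pol (discountedError γ P πs e 0) x = 0 := by
  simp [appPol, discountedError]

theorem appPol_discountedError (γ : ℝ) (πs e : ℕ → X → A → ℝ) (k : ℕ) (x : X) :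
    appPol pol (discountedError γ P πs e k) x =
      ∑ j ∈ range k, γ ^ j * appPol pol (PpolProdN P πs (k - 1) j (e (k - j))) x :=
  appPol_sum k (fun j => γ ^ j) (fun j => PpolProdN P πs (k - 1) j (e (k - j))) x

theorem discountedError_succ (γ : ℝ) (πs e : ℕ → X → A → ℝ) (k : ℕ) (x : X) (a : A) :
    discountedError γ P πs e (k + 1) x a =
      e (k + 1) x a + γ * Ppol P (πs k) (discountedError γ P πs e k) x a := by
  unfold discountedError
  rw [sum_range_succ', Ppol_sum, mul_sum, add_comm]
  congr 1
  · simp [PpolProdN]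
  · simp [PpolProdN_succ, pow_succ', mul_assoc]

end Operators

/-- The residual `α ^ k + A_{γ,k} / A_∞`, as a function of `k`. -/
noncomputable def mdviResidual (γ α : ℝ) (k : ℕ) : ℝ :=
  α ^ k + (∑ j ∈ range k, α ^ j * γ ^ (k - j)) * (1 - α)

theorem mdviResidual_succ (γ α : ℝ) (k : ℕ) :
    mdviResidual γ α (k + 1) = (1 - γ) * α ^ (k + 1) + γ * mdviResidual γ α k := by
  have hsum : ∑ j ∈ range k, α ^ j * γ ^ (k + 1 - j) =
      γ * ∑ j ∈ range k, α ^ j * γ ^ (k - j) := by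
    rw [mul_sum]
    refine sum_congr rfl fun j hj => ?_
    rw [Nat.succ_sub (mem_range.mp hj).le, pow_succ]
    ring
  rw [mdviResidual, mdviResidual, sum_range_succ, hsum, Nat.add_sub_cancel_left]
  ring

/-- Error-propagation analysis for WLS-MDVI (Lemma H.1): under the MDVI recursion with errors
`ê_k`, for every `1 ≤ k ≤ K`, `0 ≤ v_* − v_{π'_k} ≤ Γ_k` pointwise, where
`Γ_k = (1/A_∞) ∑_{j<k} γ^j (π_k P_{k−j}^{k−1} − π_* P_*^j) ê_{k−j}
      + 2H (α^k + A_{γ,k}/A_∞)·1`. -/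
theorem mdvi_error_propagation
    {X A : Type*} [Fintype X] [Fintype A] [Nonempty X] [Nonempty A]
    (γ : ℝ) (hγ0 : 0 ≤ γ) (hγ1 : γ < 1)
    (H : ℝ) (hH : H = (1 - γ)⁻¹)
    (α : ℝ) (hα0 : 0 ≤ α) (hα1 : α < 1)
    (Ainf : ℝ) (hAinf : Ainf = (1 - α)⁻¹)
    (r : X → A → ℝ) (hr : ∀ x a, |r x a| ≤ 1)
    (P : X → A → X → ℝ)
    (hPnn : ∀ x a y, 0 ≤ P x a y) (hPsum : ∀ x a, ∑ y, P x a y = 1)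
    (vstar : X → ℝ)
    (hvstar : ∀ x, vstar x =
      univ.sup' univ_nonempty (fun a => r x a + γ * appP P vstar x a))
    (πstar : X → A → ℝ) (hπstar : IsPolicy πstar)
    (qstar : X → A → ℝ) (hqstar : qstar = bellmanOp γ r P πstar qstar)
    (hopt : appPol πstar qstar = vstar)
    (K : ℕ) (e : ℕ → X → A → ℝ)
    (πs : ℕ → X → A → ℝ) (hπs : ∀ k ≤ K, IsPolicy (πs k))
    (qpi0 : X → A → ℝ) (hqpi0 : qpi0 = bellmanOp γ r P (πs 0) qpi0)
    (w : ℕ → X → ℝ) (s : ℕ → X → A → ℝ)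
    (hw0 : w 0 = 0)
    (hs : ∀ k, 1 ≤ k → k ≤ K → ∀ x a,
      s k x a = (∑ j ∈ range k, α ^ j) * r x a + γ * appP P (w (k - 1)) x a + e k x a)
    (hw : ∀ k, 1 ≤ k → k ≤ K → ∀ x,
      w k x = univ.sup' univ_nonempty (fun a => s k x a))
    (hgreedy : ∀ k, 1 ≤ k → k ≤ K → IsGreedy (πs k) (s k)) :
    ∀ k, 1 ≤ k → k ≤ K → ∀ x,
      0 ≤ vstar x - appPol (πs k) (bellmanComp γ r P πs k qpi0) x ∧
      vstar x - appPol (πs k) (bellmanComp γ r P πs k qpi0) x ≤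
        Ainf⁻¹ * (∑ j ∈ range k, γ ^ j *
            (appPol (πs k) (PpolProdN P πs (k - 1) j (e (k - j))) x -
             appPol πstar ((Ppol P πstar)^[j] (e (k - j))) x))
        + 2 * H * (α ^ k + (∑ j ∈ range k, α ^ j * γ ^ (k - j)) / Ainf) := by
  have hγ : 0 < 1 - γ := sub_pos.mpr hγ1
  have hα : 0 < 1 - α := sub_pos.mpr hα1
  have hHγ : H * (1 - γ) = 1 := by rw [hH, inv_mul_cancel₀ hγ.ne']
  have hAα : Ainf * (1 - α) = 1 := by rw [hAinf, inv_mul_cancel₀ hα.ne']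
  have hA0 : 0 < Ainf := hAinf ▸ inv_pos.mpr hα
  have hAinv : Ainf⁻¹ = 1 - α := by rw [hAinf, inv_inv]
  have hgeom : ∀ k, ∑ j ∈ range k, α ^ j = Ainf * (1 - α ^ k) := fun k => by
    rw [← geom_sum_mul_neg α k]
    linear_combination (-∑ j ∈ range k, α ^ j) * hAα
  set δ : ℕ → ℝ := fun k => H * mdviResidual γ α k with hδ
  have hδ0 : δ 0 = H := by simp [hδ, mdviResidual]
  have hδs : ∀ k, δ (k + 1) = α ^ (k + 1) + γ * δ k := fun k => by
    simp only [hδ, mdviResidual_succ]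
    linear_combination α ^ (k + 1) * hHγ
  have hq : ∀ x a, qstar x a = r x a + γ * appP P vstar x a := fun x a => by
    rw [← hopt]
    exact congrFun₂ hqstar x a
  have hq0 : ∀ x a, qpi0 x a = r x a + γ * Ppol P (πs 0) qpi0 x a := congrFun₂ hqpi0
  have hπq : ∀ pol, IsPolicy pol → ∀ x, appPol pol qstar x ≤ vstar x := fun pol hpol x => by
    rw [hvstar x]
    simpa only [hq] using appPol_le_sup' hpol qstar x
  have hqH : ∀ x a, qstar x a ≤ H := fun x a => by
    have := le_of_le_add_discount_Ppol hγ0 hγ1 hPnn hPsum hπstar (d := qstar) (c := 1)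
      (fun x a => (congrFun₂ hqstar x a).le.trans
        (add_le_add_left (abs_le.mp (hr x a)).2 _)) x a
    rwa [mul_one, ← hH] at this
  have hq0H : ∀ x a, -H ≤ qpi0 x a := fun x a => by
    have := le_of_le_add_discount_Ppol hγ0 hγ1 hPnn hPsum (hπs 0 K.zero_le)
      (d := fun x a => -qpi0 x a) (c := 1)
      (fun x a => by rw [Ppol_neg]; linarith [hq0 x a, (abs_le.mp (hr x a)).1]) x a
    rw [mul_one, ← hH] at this
    linarith
  set M : ℕ → X → A → ℝ := fun k => bellmanComp γ r P πs k qpi0 with hM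
  have hM0 : M 0 = qpi0 := rfl
  have hMs : ∀ k x a, M (k + 1) x a = r x a + γ * appP P (appPol (πs k) (M k)) x a :=
    fun k x a => congrFun₂ (bellmanComp_succ hqpi0 k) x a
  have hMq : ∀ k ≤ K, ∀ x a, M k x a ≤ qstar x a := by
    intro k
    induction k with
    | zero =>
      intro hk x a
      have := le_of_le_add_discount_Ppol hγ0 hγ1 hPnn hPsum (hπs 0 hk)
        (d := fun x a => qpi0 x a - qstar x a) (c := 0) (fun x a => by
          have := mul_le_mul_of_nonneg_left (appP_mono hPnn (hπq _ (hπs 0 hk)) x a) hγ0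
          rw [Ppol_sub, Ppol, Ppol, hq, hq0, Ppol]
          linarith) x a
      rw [hM0]
      linarith
    | succ k ih =>
      intro hk x a
      have hk' : k ≤ K := by omega
      rw [hMs, hq]
      gcongr
      exact appP_mono hPnn (fun y => (appPol_mono (hπs k hk') y (ih hk' y)).trans
        (hπq _ (hπs k hk') y)) x a
  set b : ℕ → X → A → ℝ := discountedError γ P πs e with hb
  set c : ℕ → X → A → ℝ := discountedError γ P (fun _ => πstar) e with hc
  have hupper : ∀ k ≤ K, ∀ x,
      w k x - appPol (πs k) (b k) x ≤ Ainf * (appPol (πs k) (M k) x + δ k) := by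
    intro k
    induction k with
    | zero =>
      intro hk x
      have := appPol_mono (hπs 0 hk) (q := fun _ _ => 0) (q' := fun x a => qpi0 x a + H) x
        (fun a => by linarith [hq0H x a])
      rw [appPol_add_const (hπs 0 hk)] at this
      rw [hb, appPol_discountedError_zero, hw0, hM0, hδ0]
      simpa [appPol] using mul_nonneg hA0.le (by simpa [appPol] using this)
    | succ k ih =>
      intro hk x
      have hk' : k ≤ K := by omega
      rw [hw (k + 1) (by omega) hk,
        ← (hgreedy (k + 1) (by omega) hk).appPol_eq_sup' (hπs (k + 1) hk), ← appPol_sub,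
        ← appPol_add_const (hπs (k + 1) hk), ← appPol_const_mul]
      refine appPol_mono (hπs (k + 1) hk) x fun a => ?_
      have hP := mul_le_mul_of_nonneg_left (appP_mono hPnn (ih hk') x a) hγ0
      rw [appP_sub, appP_const_mul, appP_add_const hPsum] at hP
      rw [hs (k + 1) (by omega) hk, hb, discountedError_succ, hMs, hδs, hgeom, Ppol,
        Nat.add_sub_cancel]
      have hrα := mul_le_mul_of_nonneg_left (abs_le.mp (hr x a)).1
        (mul_nonneg hA0.le (pow_nonneg hα0 (k + 1)))
      linarith
  have hlower : ∀ k ≤ K, ∀ x,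
      Ainf * (vstar x + -δ k) ≤ w k x - appPol πstar (c k) x := by
    intro k
    induction k with
    | zero =>
      intro hk x
      have hv : vstar x ≤ H := by
        rw [← hopt]
        exact appPol_le_const hπstar x (hqH x)
      rw [hc, appPol_discountedError_zero, hw0, hδ0, Pi.zero_apply, sub_zero]
      exact mul_nonpos_of_nonneg_of_nonpos hA0.le (by linarith)
    | succ k ih =>
      intro hk x
      have hk' : k ≤ K := by omega
      have hws := appPol_le_sup' hπstar (s (k + 1)) x
      rw [← hw (k + 1) (by omega) hk] at hws
      refine le_trans ?_ (sub_le_sub_right hws _)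
      rw [← appPol_sub, ← hopt, ← appPol_add_const hπstar, ← appPol_const_mul]
      refine appPol_mono hπstar x fun a => ?_
      have hP := mul_le_mul_of_nonneg_left (appP_mono hPnn (ih hk') x a) hγ0
      rw [appP_sub, appP_const_mul, appP_add_const hPsum] at hP
      rw [hs (k + 1) (by omega) hk, hc, discountedError_succ, hq, hδs, hgeom, Ppol,
        Nat.add_sub_cancel]
      have hrα := mul_le_mul_of_nonneg_left (abs_le.mp (hr x a)).2
        (mul_nonneg hA0.le (pow_nonneg hα0 (k + 1)))
      linarith
  intro k _ hk x
  refine ⟨sub_nonneg.mpr ((appPol_mono (hπs k hk) x (hMq k hk x)).trans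
    (hπq _ (hπs k hk) x)), ?_⟩
  have hsum : ∑ j ∈ range k, γ ^ j *
      (appPol (πs k) (PpolProdN P πs (k - 1) j (e (k - j))) x -
        appPol πstar ((Ppol P πstar)^[j] (e (k - j))) x) =
      appPol (πs k) (b k) x - appPol πstar (c k) x := by
    simp only [hb, hc, appPol_discountedError, PpolProdN_const, mul_sub, sum_sub_distrib]
  have hres : 2 * H * (α ^ k + (∑ j ∈ range k, α ^ j * γ ^ (k - j)) / Ainf) = 2 * δ k := by
    rw [div_eq_mul_inv, hAinv, mul_assoc]
    rfl
  rw [hsum, hres, ← sub_le_iff_le_add, inv_mul_eq_div, le_div_iff₀ hA0]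
  linarith [hupper k hk x, hlower k hk x]
end

section
/- Suppose α, γ ∈ [0,1), ε ∈ (0,1], c ∈ [1,∞), m is a natural number with m ≥ 1, and n ∈ [0,∞) is real. Let H = 1/(1−γ) and K = (m/(1−α)) · log(cH/ε). Then K^n · α^K ≤ ( m·n / ((1−α)·e) )^n · ( ε/(cH) )^{m−1}, where powers with real exponents are real powers and 0^0 := 1. -/
/-- The function `x ↦ x ^ n * exp (-x)` on `[0, ∞)` is maximal at `x = n`. -/
lemma rpow_le_div_exp_one_rpow_mul_exp {x n : ℝ} (hx : 0 ≤ x) (hn : 0 ≤ n) :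
    x ^ n ≤ (n / Real.exp 1) ^ n * Real.exp x := by
  rcases hn.eq_or_lt with rfl | hn
  · simpa using hx
  have h : x ≤ n / Real.exp 1 * Real.exp (x / n) := by
    have h1 := Real.add_one_le_exp (x / n - 1)
    rw [sub_add_cancel, Real.exp_sub, div_le_iff₀ hn] at h1
    calc x ≤ _ := h1
      _ = _ := by ring
  calc x ^ n ≤ (n / Real.exp 1 * Real.exp (x / n)) ^ n := Real.rpow_le_rpow hx h hn.le
    _ = (n / Real.exp 1) ^ n * Real.exp x := by
      rw [Real.mul_rpow (by positivity) (by positivity), ← Real.exp_mul,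
        div_mul_cancel₀ _ hn.ne']

/-- Lemma C.7: with `H = 1/(1−γ)` and `K = (m/(1−α))·log(cH/ε)`,
`K^n · α^K ≤ (mn/((1−α)e))^n · (ε/(cH))^{m−1}` (real powers for real exponents). -/
theorem iteration_count_poly_small
    (α γ ε c : ℝ) (m : ℕ) (n : ℝ)
    (hα0 : 0 ≤ α) (hα1 : α < 1) (hγ0 : 0 ≤ γ) (hγ1 : γ < 1)
    (hε0 : 0 < ε) (hε1 : ε ≤ 1) (hc : 1 ≤ c) (hm : 1 ≤ m) (hn : 0 ≤ n)
    (H K : ℝ) (hH : H = (1 - γ)⁻¹)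
    (hK : K = ((m : ℝ) / (1 - α)) * Real.log (c * H / ε)) :
    K ^ n * α ^ K ≤
      ((m : ℝ) * n / ((1 - α) * Real.exp 1)) ^ n * (ε / (c * H)) ^ (m - 1) := by
  have hα : 0 < 1 - α := sub_pos.2 hα1
  have hH1 : 1 ≤ H := hH ▸ (one_le_inv₀ (sub_pos.2 hγ1)).2 (by linarith)
  have hcH : 1 ≤ c * H := one_le_mul_of_one_le_of_one_le hc hH1
  have hq : 1 ≤ c * H / ε := (one_le_div hε0).2 (hε1.trans hcH)
  set L := Real.log (c * H / ε) with hL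
  have hL0 : 0 ≤ L := Real.log_nonneg hq
  have hq' : ε / (c * H) = Real.exp (-L) := by
    rw [Real.exp_neg, hL, Real.exp_log (by linarith), inv_div]
  have hK0 : 0 ≤ K := by rw [hK]; positivity
  have hαK : α ^ K ≤ Real.exp (-(m * L)) := by
    calc α ^ K ≤ Real.exp (α - 1) ^ K :=
          Real.rpow_le_rpow hα0 (by linarith [Real.add_one_le_exp (α - 1)]) hK0
      _ = Real.exp (-(m * L)) := by
          rw [← Real.exp_mul, hK]
          congr 1
          field_simp
          ring
  calc K ^ n * α ^ K
      ≤ ((m / (1 - α)) ^ n * ((n / Real.exp 1) ^ n * Real.exp L)) * Real.exp (-(m * L)) := by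
        rw [hK, Real.mul_rpow (by positivity) hL0, ← hK]
        gcongr
        exact rpow_le_div_exp_one_rpow_mul_exp hL0 hn
    _ = (m * n / ((1 - α) * Real.exp 1)) ^ n * (ε / (c * H)) ^ (m - 1) := by
        rw [hq', ← Real.exp_nat_mul, Nat.cast_sub hm, mul_div_mul_comm,
          Real.mul_rpow (by positivity) (by positivity), mul_assoc, mul_assoc, mul_assoc,
          ← Real.exp_add]
        congr 3
        push_cast
        ring
end
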